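/- Let A be a ring, B a subring such that A is a (left) projective B-module and A is a direct summand of A ⊗_B A as an A-bimodule. Then for all left A-modules M, N and all n ≥ 0, the restriction map Ext_A^n(M,N) → Ext_B^n(M,N) is injective. -/

import Mathlib

open CategoryTheory CategoryTheory.Abelian

universe u v w

/-- A projective module over a `B`-projective ring `A` is projective over `B`. -/
theorem Module.Projective.of_isScalarTower (B A P : Type*) [Ring B] [Ring A] [AddCommGroup P]
    [Module B A] [Module A P] [Module B P] [IsScalarTower B A A] [IsScalarTower B A P]
    [Module.Projective B A] [hP : Module.Projective A P] : Module.Projective B P := by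
  classical
  obtain ⟨σ, hσ⟩ := Module.projective_def'.mp hP
  have : Module.Projective B (P →₀ A) :=
    Module.Projective.of_equiv' (finsuppLEquivDirectSum B A P).symm
  refine Module.Projective.of_split (σ.restrictScalars B)
    ((Finsupp.linearCombination A (id : P → P)).restrictScalars B) ?_
  ext x
  exact LinearMap.congr_fun hσ x

theorem ModuleCat.projective_restrictScalars_obj {A B : Type u} [Ring A] [Ring B] [Small.{v} A]
    (f : B →+* A) (hproj : @Module.Projective B _ A _ (Module.compHom A f))
    (P : ModuleCat.{v} A) [Projective P] : Projective ((ModuleCat.restrictScalars f).obj P) := by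
  let : Module B A := Module.compHom A f
  let : Module B P := Module.compHom P f
  have : IsScalarTower B A A := ⟨fun b x y ↦ mul_assoc (f b) x y⟩
  have : IsScalarTower B A P := ⟨fun b x y ↦ mul_smul (f b) x y⟩
  have : Module.Projective B P := Module.Projective.of_isScalarTower B A P
  exact ModuleCat.projective_of_categoryTheory_projective (R := B) (.of B P)

theorem ModuleCat.shortExact_map_restrictScalars {A B : Type u} [Ring A] [Ring B] (f : B →+* A)
    {S : ShortComplex (ModuleCat.{v} A)} (hS : S.ShortExact) :
    (S.map (ModuleCat.restrictScalars.{v} f)).ShortExact where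
  exact := by
    have h := hS.exact
    rw [ShortComplex.ShortExact.moduleCat_exact_iff_function_exact] at h ⊢
    exact h
  mono_f := by
    rw [ModuleCat.mono_iff_injective]
    exact (ModuleCat.mono_iff_injective S.f).mp hS.mono_f
  epi_g := by
    rw [ModuleCat.epi_iff_surjective]
    exact (ModuleCat.epi_iff_surjective S.g).mp hS.epi_g

/-- If the counit of `F ⊣ G` has a natural section, then `G` reflects factorizations through a
given morphism. -/
theorem CategoryTheory.Adjunction.exists_comp_eq_of_counit_section {C D : Type*} [Category C]
    [Category D] {F : D ⥤ C} {G : C ⥤ D} (adj : F ⊣ G) (s : 𝟭 C ⟶ G ⋙ F)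
    (hs : ∀ X, s.app X ≫ adj.counit.app X = 𝟙 X) {X Y Z : C} (i : X ⟶ Y) (g : X ⟶ Z)
    (h : G.obj Y ⟶ G.obj Z) (hh : G.map i ≫ h = G.map g) : ∃ k : Y ⟶ Z, i ≫ k = g := by
  refine ⟨s.app Y ≫ F.map h ≫ adj.counit.app Z, ?_⟩
  have hi : i ≫ s.app Y = s.app X ≫ F.map (G.map i) := s.naturality i
  rw [reassoc_of% hi, ← F.map_comp_assoc, hh, adj.counit_naturality, reassoc_of% hs X]

/-- A version of `CategoryTheory.Adjunction.exists_comp_eq_of_counit_section` for restriction of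
scalars, where the modules may live in another universe than the adjunction, provided they are
small. -/
theorem ModuleCat.exists_comp_eq_of_counit_section {A B : Type u} [Ring A] [Ring B] (f : B →+* A)
    {I : ModuleCat.{w} B ⥤ ModuleCat.{w} A} (adj : I ⊣ ModuleCat.restrictScalars.{w} f)
    (s : 𝟭 (ModuleCat.{w} A) ⟶ ModuleCat.restrictScalars f ⋙ I)
    (hs : ∀ M, s.app M ≫ adj.counit.app M = 𝟙 M) {X Y Z : ModuleCat.{v} A}
    [Small.{0} X] [Small.{0} Y] [Small.{0} Z] (i : X ⟶ Y) (g : X ⟶ Z)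
    (h : (ModuleCat.restrictScalars f).obj Y ⟶ (ModuleCat.restrictScalars f).obj Z)
    (hh : (ModuleCat.restrictScalars f).map i ≫ h = (ModuleCat.restrictScalars f).map g) :
    ∃ k : Y ⟶ Z, i ≫ k = g := by
  have : Small.{w} X := small_lift.{v, w, 0} X
  have : Small.{w} Y := small_lift.{v, w, 0} Y
  have : Small.{w} Z := small_lift.{v, w, 0} Z
  let eX := Shrink.linearEquiv.{w} A X
  let eY := Shrink.linearEquiv.{w} A Y
  let eZ := Shrink.linearEquiv.{w} A Z
  let h' : (ModuleCat.restrictScalars f).obj (.of A (Shrink.{w} Y)) ⟶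
      (ModuleCat.restrictScalars f).obj (.of A (Shrink.{w} Z)) :=
    ModuleCat.ofHom (X := (ModuleCat.restrictScalars f).obj (.of A (Shrink.{w} Y)))
      (Y := (ModuleCat.restrictScalars f).obj (.of A (Shrink.{w} Z)))
      { toFun y := eZ.symm (h.hom (eY y))
        map_add' x y := by
          refine (congrArg (fun t ↦ eZ.symm (h.hom t)) (map_add eY x y)).trans ?_
          exact (congrArg eZ.symm (h.hom.map_add (eY x) (eY y))).trans (map_add eZ.symm _ _)
        map_smul' b y := by
          refine (congrArg (fun t ↦ eZ.symm (h.hom t)) (map_smul eY (f b) y)).trans ?_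
          exact (congrArg eZ.symm (h.hom.map_smul b (eY y))).trans (map_smul eZ.symm (f b) _) }
  obtain ⟨k, hk⟩ := adj.exists_comp_eq_of_counit_section s hs
    (ModuleCat.ofHom (eY.symm.toLinearMap ∘ₗ i.hom ∘ₗ eX.toLinearMap))
    (ModuleCat.ofHom (eZ.symm.toLinearMap ∘ₗ g.hom ∘ₗ eX.toLinearMap)) h' (by
      ext x
      change eZ.symm (h.hom (eY (eY.symm (i.hom (eX x))))) = eZ.symm (g.hom (eX x))
      rw [LinearEquiv.apply_symm_apply]
      exact congrArg eZ.symm (LinearMap.congr_fun (ModuleCat.hom_ext_iff.mp hh) (eX x)))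
  refine ⟨ModuleCat.ofHom (eZ.toLinearMap ∘ₗ k.hom ∘ₗ eY.symm.toLinearMap), ?_⟩
  ext x
  have hx := LinearMap.congr_fun (ModuleCat.hom_ext_iff.mp hk) (eX.symm x)
  apply eZ.symm.injective
  simpa using hx

/-- If the `Ext`-groups between `A`-modules are `w`-small, then so are all `A`-modules. -/
theorem ModuleCat.small_of_hasExt {A : Type u} [Ring A] [Small.{v} A]
    [HasExt.{w} (ModuleCat.{v} A)] (M : ModuleCat.{v} A) : Small.{w} M :=
  let e : Ext (ModuleCat.of A (Shrink.{v} A)) M 0 ≃ M :=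
    Ext.homEquiv₀.trans <| ModuleCat.homEquiv.trans <|
      ((Shrink.linearEquiv A A).congrLeft M ℕ).toEquiv.trans
        (LinearMap.ringLmapEquivSelf A ℕ M).toEquiv
  ⟨_, ⟨e.symm⟩⟩

/-- Let `A` be a ring and `B → A` a subring such that `A` is a projective (left)
`B`-module and `A` is a direct summand of `A ⊗_B A` as an `A`-bimodule (the latter condition
expressed functorially: the counit `A ⊗_B - : Ind ∘ Res → 𝟭` of the induction–restriction
adjunction admits a natural section). Then for all left `A`-modules `M`, `N` and all `n ≥ 0`,
the restriction map `Ext_A^n(M,N) → Ext_B^n(M,N)` (characterized as an additive map compatible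
with degree-zero classes, Yoneda composition, and the classes of short exact sequences) is
injective. -/
theorem stmt8 (A B : Type) [Ring A] [Ring B] (f : B →+* A)
    -- `A` is a projective left `B`-module (via `f`)
    (hproj : @Module.Projective B _ A _ (Module.compHom A f))
    [HasExt.{0} (ModuleCat A)] [HasExt.{0} (ModuleCat B)]
    -- induction ⊣ restriction, and `A` is a bimodule direct summand of `A ⊗_B A`:
    -- the counit of the adjunction splits naturally
    (I : ModuleCat B ⥤ ModuleCat A)
    (adj : I ⊣ ModuleCat.restrictScalars f)
    (s : 𝟭 (ModuleCat A) ⟶ ModuleCat.restrictScalars f ⋙ I)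
    (hs : ∀ M : ModuleCat A, s.app M ≫ adj.counit.app M = 𝟙 M)
    -- the restriction map on Ext
    (ψ : ∀ (M N : ModuleCat A) (n : ℕ), Ext M N n →+
      Ext ((ModuleCat.restrictScalars f).obj M) ((ModuleCat.restrictScalars f).obj N) n)
    (hψ₀ : ∀ (M N : ModuleCat A) (φ : M ⟶ N),
      ψ M N 0 (Ext.mk₀ φ) = Ext.mk₀ ((ModuleCat.restrictScalars f).map φ))
    (hψcomp : ∀ (M N P : ModuleCat A) (a b c : ℕ) (h : a + b = c)
      (α : Ext M N a) (β : Ext N P b),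
      ψ M P c (α.comp β h) = (ψ M N a α).comp (ψ N P b β) h)
    (hψext : ∀ (S : ShortComplex (ModuleCat A)) (hS : S.ShortExact)
      (hS' : (S.map (ModuleCat.restrictScalars f)).ShortExact),
      ψ S.X₃ S.X₁ 1 hS.extClass = hS'.extClass) :
    ∀ (M N : ModuleCat A) (n : ℕ), Function.Injective (ψ M N n) := by
  intro M N n
  rw [injective_iff_map_eq_zero]
  induction n generalizing M with
  | zero =>
    intro x hx
    obtain ⟨φ, rfl⟩ := (Ext.mk₀_bijective M N).2 x
    rw [hψ₀, Ext.mk₀_eq_zero_iff] at hx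
    rw [Ext.mk₀_eq_zero_iff]
    exact (ModuleCat.restrictScalars f).map_injective (by rw [hx, Functor.map_zero])
  | succ n ih =>
    intro x hx
    let S : ShortComplex (ModuleCat A) :=
      ShortComplex.mk (Limits.kernel.ι (Projective.π M)) (Projective.π M) (by simp)
    have hS : S.ShortExact := { exact := ShortComplex.exact_kernel (Projective.π M) }
    have hS' := ModuleCat.shortExact_map_restrictScalars f hS
    have : Projective S.X₂ := inferInstanceAs (Projective (Projective.over M))
    have : Projective (S.map (ModuleCat.restrictScalars f)).X₂ :=
      ModuleCat.projective_restrictScalars_obj f hproj S.X₂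
    obtain ⟨y, rfl⟩ := Ext.contravariant_sequence_exact₃ hS N x
      (Ext.eq_zero_of_projective _) (add_comm 1 n)
    rw [hψcomp _ _ _ _ _ _ _ hS.extClass y, hψext S hS hS'] at hx
    obtain ⟨z, hz⟩ := Ext.contravariant_sequence_exact₁ hS' _ _ _ hx
    cases n with
    | zero =>
      obtain ⟨g, rfl⟩ := (Ext.mk₀_bijective _ _).2 y
      obtain ⟨h, rfl⟩ := (Ext.mk₀_bijective _ _).2 z
      rw [hψ₀, Ext.mk₀_comp_mk₀] at hz
      have := ModuleCat.small_of_hasExt.{_, _, 0} S.X₁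
      have := ModuleCat.small_of_hasExt.{_, _, 0} S.X₂
      have := ModuleCat.small_of_hasExt.{_, _, 0} N
      obtain ⟨k, rfl⟩ := ModuleCat.exists_comp_eq_of_counit_section f adj s hs S.f g h
        ((Ext.mk₀_bijective _ _).1 hz)
      rw [← Ext.mk₀_comp_mk₀, hS.extClass_comp_assoc]
    | succ n =>
      rw [Ext.eq_zero_of_projective z, Ext.comp_zero] at hz
      rw [ih S.X₁ y hz.symm, Ext.comp_zero]
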